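/- Fix 2 ≤ p < 3 and p − 2 < ρ ≤ 1, and let E be a Banach space. Let V, W : E → E be vector fields with ‖V‖_{C^{2+ρ}} ≤ K ε and ‖W‖_{C^{1+ρ}} ≤ K ε², where ε ∈ (0,1] and K > 0. Then there exists a constant c, depending only on p, ρ and K, such that for every f : E → ℝ of class C^{2,ρ}_b, every x ∈ E, and every solution y : [0,1] → E of the ordinary differential equation ẏ_u = V(y_u) + W(y_u) with y_0 = x, one has | f(y_1) − f(x) − (Vf)(x) − (Wf)(x) − (1/2)(V(Vf))(x) | ≤ c ‖f‖_{C^{2+ρ}} ε³⁻⁽¹⁻ρ⁾, that is, the error is bounded by c ‖f‖_{C^{2+ρ}} (ε³ + ε^{2+ρ}). In particular, when ε = |t−s|^{1/p}, V = V_{ts} and W = W_{ts} come from a weak geometric (p,ρ)-rough driver of norm at most K, the time-1 map μ_{ts} satisfies ‖ f ∘ μ_{ts} − ( f + V_{ts} f + 𝕍_{ts} f ) ‖_∞ ≤ c ‖f‖_{C^{2+ρ}} |t−s|^{(2+ρ)∧3 / p}. -/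

import Mathlib

open Set

/-- A weak geometric `(p,ρ)`-rough driver on `[0,T]` over a Banach space `E`: a pair of
families of vector fields `(V_{ts}, W_{ts})`, with `V_{ts}` of class `C^{2,ρ}_b` (derivatives
`DV`, `D2V`) and `W_{ts}` of class `C^{1,ρ}_b` (derivative `DW`), satisfying the additivity
and Chen-type relations, all norms being controlled by `B |t−s|^{1/p}` resp. `B |t−s|^{2/p}`
for an upper bound `B` of the driver norm `‖𝒱‖`. -/
structure RoughDriver (E : Type*) [NormedAddCommGroup E] [NormedSpace ℝ E]
    (p ρ T : ℝ) where
  V : ℝ → ℝ → E → E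
  W : ℝ → ℝ → E → E
  DV : ℝ → ℝ → E → E →L[ℝ] E
  D2V : ℝ → ℝ → E → E →L[ℝ] E →L[ℝ] E
  DW : ℝ → ℝ → E → E →L[ℝ] E
  B : ℝ
  B_nonneg : 0 ≤ B
  hasDV : ∀ s t : ℝ, 0 ≤ s → s ≤ t → t ≤ T → ∀ x, HasFDerivAt (V t s) (DV t s x) x
  hasD2V : ∀ s t : ℝ, 0 ≤ s → s ≤ t → t ≤ T → ∀ x, HasFDerivAt (DV t s) (D2V t s x) x
  hasDW : ∀ s t : ℝ, 0 ≤ s → s ≤ t → t ≤ T → ∀ x, HasFDerivAt (W t s) (DW t s x) x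
  normV : ∀ s t : ℝ, 0 ≤ s → s ≤ t → t ≤ T → ∀ x,
    ‖V t s x‖ ≤ B * (t - s) ^ (1/p) ∧ ‖DV t s x‖ ≤ B * (t - s) ^ (1/p) ∧
      ‖D2V t s x‖ ≤ B * (t - s) ^ (1/p)
  holderV : ∀ s t : ℝ, 0 ≤ s → s ≤ t → t ≤ T → ∀ x y,
    ‖D2V t s x - D2V t s y‖ ≤ B * (t - s) ^ (1/p) * ‖x - y‖ ^ ρ
  normW : ∀ s t : ℝ, 0 ≤ s → s ≤ t → t ≤ T → ∀ x,
    ‖W t s x‖ ≤ B * (t - s) ^ (2/p) ∧ ‖DW t s x‖ ≤ B * (t - s) ^ (2/p)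
  holderW : ∀ s t : ℝ, 0 ≤ s → s ≤ t → t ≤ T → ∀ x y,
    ‖DW t s x - DW t s y‖ ≤ B * (t - s) ^ (2/p) * ‖x - y‖ ^ ρ
  additive : ∀ s u t : ℝ, 0 ≤ s → s ≤ u → u ≤ t → t ≤ T → ∀ x,
    V t s x = V t u x + V u s x
  chen : ∀ s u t : ℝ, 0 ≤ s → s ≤ u → u ≤ t → t ≤ T → ∀ x,
    W t s x = W t u x + W u s x
      + (1/2 : ℝ) • (DV t u x (V u s x) - DV u s x (V t u x))

theorem aux_lip {E F : Type*} [NormedAddCommGroup E] [NormedSpace ℝ E]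
    [NormedAddCommGroup F] [NormedSpace ℝ F] (g : E → F) (Dg : E → E →L[ℝ] F) (C d : ℝ)
    (hg : ∀ x, HasFDerivAt g (Dg x) x) (hC : ∀ x, ‖Dg x‖ ≤ C) (x y : E) (hd : ‖y - x‖ ≤ d) :
    ‖g y - g x‖ ≤ C * d := by
  have h := convex_univ.norm_image_sub_le_of_norm_hasFDerivWithin_le (f := g) (f' := Dg) (C := C)
    (fun z _ => (hg z).hasFDerivWithinAt) (fun z _ => hC z) (mem_univ x) (mem_univ y)
  have hC0 : 0 ≤ C := (norm_nonneg _).trans (hC x)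
  exact h.trans (mul_le_mul_of_nonneg_left hd hC0)

theorem aux_app {F G : Type*} [NormedAddCommGroup F] [NormedSpace ℝ F]
    [NormedAddCommGroup G] [NormedSpace ℝ G] (L : F →L[ℝ] G) (v : F) (a b : ℝ)
    (hL : ‖L‖ ≤ a) (hv : ‖v‖ ≤ b) : ‖L v‖ ≤ a * b :=
  L.le_of_opNorm_le_of_le hL hv

theorem aux_app_sub {F G : Type*} [NormedAddCommGroup F] [NormedSpace ℝ F]
    [NormedAddCommGroup G] [NormedSpace ℝ G] (L M : F →L[ℝ] G) (v w : F) (a b c d : ℝ)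
    (hLM : ‖L - M‖ ≤ a) (hv : ‖v‖ ≤ b) (hM : ‖M‖ ≤ c) (hvw : ‖v - w‖ ≤ d) :
    ‖L v - M w‖ ≤ a * b + c * d := by
  have e : L v - M w = (L - M) v + M (v - w) := by simp
  rw [e]
  exact (norm_add_le _ _).trans (add_le_add (aux_app _ _ _ _ hLM hv) (aux_app _ _ _ _ hM hvw))

theorem aux_core {E : Type*} [NormedAddCommGroup E] [NormedSpace ℝ E]
    (ρ K : ℝ) (hρ : 0 < ρ) (hρ₂ : ρ ≤ 1) (hK : 0 < K) (ε : ℝ) (hε : 0 ≤ ε) (hε1 : ε ≤ 1)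
    (V W : E → E) (DV : E → E →L[ℝ] E) (D2V : E → E →L[ℝ] E →L[ℝ] E) (DW : E → E →L[ℝ] E)
    (hV : ∀ x, HasFDerivAt V (DV x) x) (hDV : ∀ x, HasFDerivAt DV (D2V x) x)
    (hW : ∀ x, HasFDerivAt W (DW x) x)
    (nV : ∀ x, ‖V x‖ ≤ K * ε ∧ ‖DV x‖ ≤ K * ε ∧ ‖D2V x‖ ≤ K * ε)
    (nW : ∀ x, ‖W x‖ ≤ K * ε ^ 2 ∧ ‖DW x‖ ≤ K * ε ^ 2)
    (f : E → ℝ) (Df : E → E →L[ℝ] ℝ) (D2f : E → E →L[ℝ] E →L[ℝ] ℝ) (Nf : ℝ)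
    (hf : ∀ x, HasFDerivAt f (Df x) x) (hDf : ∀ x, HasFDerivAt Df (D2f x) x)
    (nf : ∀ x, |f x| ≤ Nf ∧ ‖Df x‖ ≤ Nf ∧ ‖D2f x‖ ≤ Nf)
    (hol : ∀ x y, ‖D2f x - D2f y‖ ≤ Nf * ‖x - y‖ ^ ρ)
    (x : E) (y : ℝ → E) (y0 : y 0 = x)
    (hy : ∀ u ∈ Icc (0:ℝ) 1, HasDerivAt y (V (y u) + W (y u)) u) :
    |f (y 1) - f x - Df x (V x) - Df x (W x)
        - (1/2) * (D2f x (V x) (V x) + Df x (DV x (V x)))|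
      ≤ (K ^ 2 * (2 * K) ^ ρ + 10 * K ^ 3 + 6 * K ^ 2) * Nf * ε ^ (2 + ρ) := by
  have hN : 0 ≤ Nf := (abs_nonneg _).trans (nf x).1
  set a := K * ε with ha
  set b := K * ε ^ 2 with hb
  set δ := 2 * K * ε with hδ
  have a0 : 0 ≤ a := by positivity
  have b0 : 0 ≤ b := by positivity
  have δ0 : 0 ≤ δ := by positivity
  have hab : a + b ≤ δ := by
    have : K * ε ^ 2 ≤ K * ε := by
      apply mul_le_mul_of_nonneg_left _ hK.le
      nlinarith
    simp only [ha, hb, hδ]; linarith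
  -- displacement
  have hd : ∀ u ∈ Icc (0:ℝ) 1, ‖y u - x‖ ≤ δ := by
    intro u hu
    have h := norm_image_sub_le_of_norm_deriv_le_segment' (f := y) (C := δ)
      (fun u hu => (hy u hu).hasDerivWithinAt)
      (fun u _ => ((norm_add_le _ _).trans (add_le_add (nV (y u)).1 (nW (y u)).1)).trans hab) u hu
    rw [y0] at h
    refine h.trans ?_
    have := hu.2
    nlinarith
  set G := D2f x (V x) (V x) + Df x (DV x (V x)) with hG
  set A := Nf * (a ^ 2 * δ ^ ρ + 5 * a ^ 2 * δ) + 2 * Nf * a * b with hA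
  have A0 : 0 ≤ A := by positivity
  -- first order term
  have h1 : ∀ u ∈ Icc (0:ℝ) 1, ‖Df (y u) (V (y u)) - Df x (V x) - u * G‖ ≤ A := by
    intro u hu
    have hder : ∀ u ∈ Icc (0:ℝ) 1, HasDerivAt (fun u => Df (y u) (V (y u)) - u * G)
        ((D2f (y u) (V (y u) + W (y u)) (V (y u))
          + Df (y u) (DV (y u) (V (y u) + W (y u)))) - G) u := by
      intro u hu
      have e1 := (hDf (y u)).comp_hasDerivAt u (hy u hu)
      have e2 := (hV (y u)).comp_hasDerivAt u (hy u hu)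
      have e3 := e1.clm_apply e2
      have e4 := (hasDerivAt_id u).mul_const G
      rw [one_mul] at e4
      exact e3.sub e4
    have hbd : ∀ u ∈ Ico (0:ℝ) 1, ‖(D2f (y u) (V (y u) + W (y u)) (V (y u))
          + Df (y u) (DV (y u) (V (y u) + W (y u)))) - G‖ ≤ A := by
      intro u hu
      have hdu := hd u ⟨hu.1, hu.2.le⟩
      generalize y u = z at hdu ⊢
      have lV := aux_lip V DV a δ hV (fun x => (nV x).2.1) x z hdu
      have lDV := aux_lip DV D2V a δ hDV (fun x => (nV x).2.2) x z hdu
      have lDf := aux_lip Df D2f Nf δ hDf (fun x => (nf x).2.2) x z hdu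
      have lD2f : ‖D2f z - D2f x‖ ≤ Nf * δ ^ ρ := (hol z x).trans
        (mul_le_mul_of_nonneg_left (Real.rpow_le_rpow (norm_nonneg _) hdu hρ.le) hN)
      have t1 := aux_app_sub _ _ _ _ _ _ _ _
        (aux_app_sub _ _ _ _ _ _ _ _ lD2f (nV z).1 (nf x).2.2 lV) (nV z).1
        (aux_app _ _ _ _ (nf x).2.2 (nV x).1) lV
      have t2 := aux_app_sub _ _ _ _ _ _ _ _ lDf (aux_app _ _ _ _ (nV z).2.1 (nV z).1)
        (nf x).2.1 (aux_app_sub _ _ _ _ _ _ _ _ lDV (nV z).1 (nV x).2.1 lV)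
      have t3 := aux_app _ _ _ _ (aux_app _ _ _ _ (nf z).2.2 (nW z).1) (nV z).1
      have t4 := aux_app _ _ _ _ (nf z).2.1 (aux_app _ _ _ _ (nV z).2.1 (nW z).1)
      have e : D2f z (V z + W z) (V z) + Df z (DV z (V z + W z)) - G
          = ((D2f z (V z) (V z) - D2f x (V x) (V x)) + (Df z (DV z (V z)) - Df x (DV x (V x))))
            + (D2f z (W z) (V z) + Df z (DV z (W z))) := by
        simp only [map_add, ContinuousLinearMap.add_apply, hG]; ring
      rw [e]
      refine (norm_add_le _ _).trans ?_
      refine (add_le_add ((norm_add_le _ _).trans (add_le_add t1 t2))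
        ((norm_add_le _ _).trans (add_le_add t3 t4))).trans (le_of_eq ?_)
      rw [hA]; ring
    have h := norm_image_sub_le_of_norm_deriv_le_segment'
      (fun u hu => (hder u hu).hasDerivWithinAt) hbd u hu
    simp only [y0, zero_mul, sub_zero] at h
    rw [sub_right_comm]
    refine h.trans ?_
    have := hu.2
    nlinarith
  have hder : ∀ u ∈ Icc (0:ℝ) 1, HasDerivAt
      (fun u => f (y u) - u * (Df x (V x) + Df x (W x)) - u ^ 2 * (1/2 * G))
      (Df (y u) (V (y u) + W (y u)) - (Df x (V x) + Df x (W x)) - u * G) u := by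
    intro u hu
    have e1 := (hf (y u)).comp_hasDerivAt u (hy u hu)
    have e2 := (hasDerivAt_id u).mul_const (Df x (V x) + Df x (W x))
    have e3 := (hasDerivAt_pow 2 u).mul_const (1/2 * G)
    have e4 := (e1.sub e2).sub e3
    refine e4.congr_deriv ?_
    push_cast
    ring
  have hbd : ∀ u ∈ Ico (0:ℝ) 1,
      ‖Df (y u) (V (y u) + W (y u)) - (Df x (V x) + Df x (W x)) - u * G‖
        ≤ A + 2 * Nf * δ * b := by
    intro u hu
    have hu' : u ∈ Icc (0:ℝ) 1 := ⟨hu.1, hu.2.le⟩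
    have hdu := hd u hu'
    have q := h1 u hu'
    generalize y u = z at hdu q ⊢
    have lW := aux_lip W DW b δ hW (fun x => (nW x).2) x z hdu
    have lDf := aux_lip Df D2f Nf δ hDf (fun x => (nf x).2.2) x z hdu
    have t := aux_app_sub _ _ _ _ _ _ _ _ lDf (nW z).1 (nf x).2.1 lW
    have e : Df z (V z + W z) - (Df x (V x) + Df x (W x)) - u * G
        = (Df z (V z) - Df x (V x) - u * G) + (Df z (W z) - Df x (W x)) := by
      rw [map_add]; ring
    rw [e]
    refine (norm_add_le _ _).trans ((add_le_add q t).trans (le_of_eq ?_))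
    ring
  have h := norm_image_sub_le_of_norm_deriv_le_segment'
      (fun u hu => (hder u hu).hasDerivWithinAt) hbd 1 ⟨zero_le_one, le_rfl⟩
  rw [Real.norm_eq_abs] at h
  have hpow : ε ^ (2 + ρ) = ε ^ 2 * ε ^ ρ := by
    rw [Real.rpow_add_of_nonneg hε (by norm_num) hρ.le]; norm_num
  have h3 : ε ^ 3 ≤ ε ^ (2 + ρ) := by
    rw [hpow, pow_succ]
    apply mul_le_mul_of_nonneg_left _ (by positivity)
    exact Real.self_le_rpow_of_le_one hε hε1 hρ₂
  have hδρ : δ ^ ρ = (2 * K) ^ ρ * ε ^ ρ := by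
    rw [hδ, Real.mul_rpow (by positivity) hε]
  calc _ ≤ _ := le_of_eq (by congr 1; simp only [y0]; ring)
    _ ≤ _ := h
    _ = (K ^ 2 * (2 * K) ^ ρ) * Nf * ε ^ (2 + ρ) + (10 * K ^ 3 + 6 * K ^ 2) * Nf * ε ^ 3 := by
      rw [hA, hδρ, hpow, ha, hb, hδ]; ring
    _ ≤ (K ^ 2 * (2 * K) ^ ρ) * Nf * ε ^ (2 + ρ)
        + (10 * K ^ 3 + 6 * K ^ 2) * Nf * ε ^ (2 + ρ) := by gcongr
    _ = _ := by ring

/-- **Euler–Taylor expansion for the time-1 map of the approximate-flow ODE**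
(Proposition `PropFundamentalEstimate`).  Fix `2 ≤ p < 3`, `p − 2 < ρ ≤ 1` and `K > 0`.  There is
a constant `c = c(p,ρ,K)` such that for every `ε ∈ (0,1]` and all vector fields `V, W` with
`‖V‖_{C^{2+ρ}} ≤ Kε`, `‖W‖_{C^{1+ρ}} ≤ Kε²`, every `C^{2,ρ}_b` function `f`, every `x` and every
solution `y` of `ẏ = V(y) + W(y)` on `[0,1]` with `y 0 = x`:
`|f(y₁) − f(x) − (Vf)(x) − (Wf)(x) − ½(V(Vf))(x)| ≤ c ‖f‖_{C^{2+ρ}} (ε³ + ε^{2+ρ})`.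
In particular, for a weak geometric `(p,ρ)`-rough driver of norm at most `K` on `[0,T]` with
`T ≤ 1` in the relevant scale, the time-1 maps `μ_{ts}` satisfy
`‖f ∘ μ_{ts} − (f + V_{ts}f + 𝕍_{ts}f)‖_∞ ≤ c ‖f‖_{C^{2+ρ}} |t−s|^{((2+ρ) ⊓ 3)/p}`. -/
theorem euler_taylor_expansion_time_one_map
    {E : Type*} [NormedAddCommGroup E] [NormedSpace ℝ E] [CompleteSpace E]
    (p ρ K : ℝ) (hp₁ : 2 ≤ p) (hp₂ : p < 3) (hρ₁ : p - 2 < ρ) (hρ₂ : ρ ≤ 1) (hK : 0 < K) :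
    ∃ c > (0:ℝ),
      (∀ ε : ℝ, 0 < ε → ε ≤ 1 →
        ∀ (V W : E → E) (DV : E → E →L[ℝ] E) (D2V : E → E →L[ℝ] E →L[ℝ] E)
          (DW : E → E →L[ℝ] E),
        (∀ x, HasFDerivAt V (DV x) x) → (∀ x, HasFDerivAt DV (D2V x) x) →
        (∀ x, HasFDerivAt W (DW x) x) →
        (∀ x, ‖V x‖ ≤ K * ε ∧ ‖DV x‖ ≤ K * ε ∧ ‖D2V x‖ ≤ K * ε) →
        (∀ x y, ‖D2V x - D2V y‖ ≤ K * ε * ‖x - y‖ ^ ρ) →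
        (∀ x, ‖W x‖ ≤ K * ε ^ 2 ∧ ‖DW x‖ ≤ K * ε ^ 2) →
        (∀ x y, ‖DW x - DW y‖ ≤ K * ε ^ 2 * ‖x - y‖ ^ ρ) →
        ∀ (f : E → ℝ) (Df : E → E →L[ℝ] ℝ) (D2f : E → E →L[ℝ] E →L[ℝ] ℝ) (Nf : ℝ),
        (∀ x, HasFDerivAt f (Df x) x) → (∀ x, HasFDerivAt Df (D2f x) x) →
        (∀ x, |f x| ≤ Nf ∧ ‖Df x‖ ≤ Nf ∧ ‖D2f x‖ ≤ Nf) →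
        (∀ x y, ‖D2f x - D2f y‖ ≤ Nf * ‖x - y‖ ^ ρ) →
        ∀ (x : E) (y : ℝ → E), y 0 = x →
        (∀ u ∈ Icc (0:ℝ) 1, HasDerivAt y (V (y u) + W (y u)) u) →
        |f (y 1) - f x - Df x (V x) - Df x (W x)
            - (1/2) * (D2f x (V x) (V x) + Df x (DV x (V x)))|
          ≤ c * Nf * (ε ^ 3 + ε ^ (2 + ρ)))
      ∧
      (∀ (T : ℝ), 0 < T → ∀ 𝒱 : RoughDriver E p ρ T, 𝒱.B ≤ K →
        ∀ μ : ℝ → ℝ → E → E,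
        (∀ s t : ℝ, 0 ≤ s → s ≤ t → t ≤ T → ∀ x : E, ∃ y : ℝ → E,
          y 0 = x ∧ y 1 = μ t s x ∧
          ∀ u ∈ Icc (0:ℝ) 1, HasDerivAt y (𝒱.V t s (y u) + 𝒱.W t s (y u)) u) →
        ∀ (f : E → ℝ) (Df : E → E →L[ℝ] ℝ) (D2f : E → E →L[ℝ] E →L[ℝ] ℝ) (Nf : ℝ),
        (∀ x, HasFDerivAt f (Df x) x) → (∀ x, HasFDerivAt Df (D2f x) x) →
        (∀ x, |f x| ≤ Nf ∧ ‖Df x‖ ≤ Nf ∧ ‖D2f x‖ ≤ Nf) →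
        (∀ x y, ‖D2f x - D2f y‖ ≤ Nf * ‖x - y‖ ^ ρ) →
        ∀ s t : ℝ, 0 ≤ s → s ≤ t → t ≤ T → (t - s) ^ ((1:ℝ)/p) ≤ 1 →
        ∀ x : E,
          |f (μ t s x) - f x - Df x (𝒱.V t s x)
              - (Df x (𝒱.W t s x)
                + (1/2) * (D2f x (𝒱.V t s x) (𝒱.V t s x)
                    + Df x (𝒱.DV t s x (𝒱.V t s x))))|
            ≤ c * Nf * (t - s) ^ (min (2 + ρ) 3 / p)) := by
  have hρ : 0 < ρ := by linarith
  have hp : 0 < p := by linarith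
  refine ⟨K ^ 2 * (2 * K) ^ ρ + 10 * K ^ 3 + 6 * K ^ 2, by positivity, ?_, ?_⟩
  · intro ε hε hε1 V W DV D2V DW hV hDV hW nV _ nW _ f Df D2f Nf hf hDf nf hol x y y0 hy
    have hN : 0 ≤ Nf := (abs_nonneg _).trans (nf x).1
    refine (aux_core ρ K hρ hρ₂ hK ε hε.le hε1 V W DV D2V DW hV hDV hW nV nW f Df D2f Nf hf hDf
      nf hol x y y0 hy).trans ?_
    have : 0 ≤ ε ^ 3 := by positivity
    exact mul_le_mul_of_nonneg_left (by linarith) (by positivity)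
  · intro T _ 𝒱 hB μ hμ f Df D2f Nf hf hDf nf hol s t hs hst htT h1 x
    obtain ⟨y, y0, y1, hy⟩ := hμ s t hs hst htT x
    have hts : 0 ≤ t - s := by linarith
    have e0 : 0 ≤ (t - s) ^ (1 / p) := by positivity
    have e2 : (t - s) ^ (2 / p) = ((t - s) ^ (1 / p)) ^ 2 := by
      rw [← Real.rpow_natCast, ← Real.rpow_mul hts]; congr 1; push_cast; ring
    have e3 : (t - s) ^ (min (2 + ρ) 3 / p) = ((t - s) ^ (1 / p)) ^ (2 + ρ) := by
      rw [min_eq_left (by linarith), ← Real.rpow_mul hts]; congr 1; ring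
    have k1 : 𝒱.B * (t - s) ^ (1 / p) ≤ K * (t - s) ^ (1 / p) := by gcongr
    have k2 : 𝒱.B * (t - s) ^ (2 / p) ≤ K * ((t - s) ^ (1 / p)) ^ 2 := by
      rw [e2]; gcongr
    have h := aux_core ρ K hρ hρ₂ hK _ e0 h1 (𝒱.V t s) (𝒱.W t s) (𝒱.DV t s) (𝒱.D2V t s)
      (𝒱.DW t s) (𝒱.hasDV s t hs hst htT) (𝒱.hasD2V s t hs hst htT) (𝒱.hasDW s t hs hst htT)
      (fun z => let n := 𝒱.normV s t hs hst htT z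
        ⟨n.1.trans k1, n.2.1.trans k1, n.2.2.trans k1⟩)
      (fun z => let n := 𝒱.normW s t hs hst htT z
        ⟨n.1.trans k2, n.2.trans k2⟩)
      f Df D2f Nf hf hDf nf hol x y y0 hy
    rw [e3, ← y1, ← sub_sub]
    exact h
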